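/- Let G be an additively written abelian group, let n ≥ 1 and g ≥ 1 be integers, and let α ∈ G. Suppose that for all positive integers k, l with k ≡ l (mod n) there exist natural numbers a, b (depending on k and l) such that (k^a · l^b · (l^{2g} − k^{2g})) · α = 0 in G. Then (2g · n · N_{2g}) · α = 0 in G, where N_{2g} := 2 · (denominator of B_{2g}/(2g)) and B_{2g} is the 2g-th Bernoulli number. -/

import Mathlib

/-- Every prime `p` with `p - 1 ∣ 2 * k` divides the denominator of `bernoulli (2 * k)`. -/
theorem dvd_den_bernoulli_of_sub_one_dvd {k p : ℕ} (hk : 0 < k) (hp : p.Prime)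
    (hdvd : p - 1 ∣ 2 * k) : p ∣ (bernoulli (2 * k)).den := by
  obtain ⟨z, hz⟩ := Bernoulli.vonStaudt_clausen k
  set S := (Finset.range (2 * k + 2)).filter fun q ↦ q.Prime ∧ (q - 1) ∣ 2 * k
  have hmem : p ∈ S := Finset.mem_filter.mpr
    ⟨Finset.mem_range.mpr (by have := Nat.le_of_dvd (by lia) hdvd; lia), hp, hdvd⟩
  rw [← Finset.add_sum_erase _ _ hmem] at hz
  have hrest : (∑ q ∈ S.erase p, (1 : ℚ) / q).den.Coprime p := by
    refine Nat.Coprime.of_dvd_left (Finset.Rat.den_sum_dvd_prod_den _ _)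
      (Nat.Coprime.prod_left fun q hq ↦ ?_)
    obtain ⟨hne, hq⟩ := Finset.mem_erase.mp hq
    have hq_prime := (Finset.mem_filter.mp hq).2.1
    rw [show ((1 : ℚ) / q).den = q by simp [hq_prime.ne_zero]]
    exact (Nat.coprime_primes hq_prime hp).mpr hne
  by_contra hnot
  have hsum := Nat.Coprime.of_dvd_left (Rat.add_den_dvd _ _)
    (((hp.coprime_iff_not_dvd.mpr hnot).symm).mul_left hrest)
  have hinv : (1 : ℚ) / p =
      z - (bernoulli (2 * k) + ∑ q ∈ S.erase p, (1 : ℚ) / q) := by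
    rw [hz]; ring
  have hden : ((1 : ℚ) / p).den = p := by simp [hp.ne_zero]
  have hdiv := Rat.sub_den_dvd (z : ℚ) (bernoulli (2 * k) + ∑ q ∈ S.erase p, (1 : ℚ) / q)
  rw [← hinv, hden, Rat.den_intCast, one_mul] at hdiv
  exact hp.one_lt.ne' (hsum.symm.eq_one_of_dvd hdiv)

/-- Every prime `p` with `p - 1 ∣ 2 * k` divides the denominator of `bernoulli (2 * k) / (2 * k)`. -/
theorem dvd_den_bernoulli_div_of_sub_one_dvd {k p : ℕ} (hk : 0 < k) (hp : p.Prime)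
    (hdvd : p - 1 ∣ 2 * k) : p ∣ (bernoulli (2 * k) / (2 * k : ℚ)).den := by
  refine (dvd_den_bernoulli_of_sub_one_dvd hk hp hdvd).trans ?_
  have hmul := Rat.mul_den_dvd (bernoulli (2 * k) / (2 * k : ℚ)) ((2 * k : ℕ) : ℚ)
  rwa [Rat.den_natCast, mul_one, Nat.cast_mul, Nat.cast_ofNat,
    div_mul_cancel₀ _ (by positivity)] at hmul

/-- Lifting the exponent at an odd prime, for a base congruent to `1`. -/
theorem pow_dvd_mul_of_pow_dvd_one_add_pow_sub_one {p : ℕ} (hp : p.Prime) (hodd : Odd p)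
    {c m j : ℕ} (hc : p ∣ c) (h : (p : ℤ) ^ j ∣ (1 + c : ℤ) ^ m - 1) : p ^ j ∣ c * m := by
  have hp' := Nat.prime_iff_prime_int.mp hp
  have hc' : (p : ℤ) ∣ c := Int.natCast_dvd_natCast.mpr hc
  have hlte := Int.emultiplicity_pow_sub_pow hp hodd (x := 1 + c) (y := 1) (by simpa using hc')
    (fun hd ↦ hp'.not_dvd_one ((dvd_add_left hc').mp hd)) m
  rw [one_pow, add_sub_cancel_left, ← Int.natCast_emultiplicity, ← emultiplicity_mul hp'] at hlte
  rw [pow_dvd_iff_le_emultiplicity, hlte, ← pow_dvd_iff_le_emultiplicity] at h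
  exact_mod_cast h

/-- Lifting the exponent at `2`, for a base congruent to `1` modulo `4`. -/
theorem two_pow_dvd_mul_of_two_pow_dvd_one_add_pow_sub_one {c m j : ℕ} (hc : 4 ∣ c)
    (h : (2 : ℤ) ^ j ∣ (1 + c : ℤ) ^ m - 1) : 2 ^ j ∣ c * m := by
  have hlte := Int.two_pow_sub_pow' (x := 1 + c) (y := 1) m (by lia) (by lia)
  rw [one_pow, add_sub_cancel_left, ← emultiplicity_mul Int.prime_two] at hlte
  rw [pow_dvd_iff_le_emultiplicity, hlte, ← pow_dvd_iff_le_emultiplicity] at h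
  exact_mod_cast h

/-- If `p ∤ n` and `p - 1 ∤ m`, some `l ≡ 1 [MOD n]` is prime to `p` and satisfies
`l ^ m ≢ 1` modulo `p`. -/
theorem exists_modEq_one_not_dvd_pow_sub_one {p n m : ℕ} (hp : p.Prime) (hpn : ¬p ∣ n)
    (hm : ¬p - 1 ∣ m) :
    ∃ l : ℕ, 1 ≡ l [MOD n] ∧ ¬p ∣ l ∧ ¬(p : ℤ) ∣ (l : ℤ) ^ m - 1 := by
  have : Fact p.Prime := ⟨hp⟩
  have hunit : ∃ x : (ZMod p)ˣ, x ^ m ≠ 1 := by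
    by_contra! hall
    exact hm (by simpa [ZMod.card] using (FiniteField.forall_pow_eq_one_iff (ZMod p) m).mp hall)
  obtain ⟨x, hx⟩ := hunit
  obtain ⟨l, hl_n, hl_p⟩ := Nat.chineseRemainder
    (hp.coprime_iff_not_dvd.mpr hpn).symm 1 (x : ZMod p).val
  have hlx : (l : ZMod p) = x := by
    rw [(ZMod.natCast_eq_natCast_iff _ _ _).mpr hl_p, ZMod.natCast_zmod_val]
  refine ⟨l, hl_n.symm, fun hd ↦ ?_, fun hd ↦ hx ?_⟩
  · rw [← ZMod.natCast_eq_zero_iff, hlx] at hd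
    exact x.ne_zero hd
  · rw [← ZMod.intCast_zmod_eq_zero_iff_dvd] at hd
    push_cast at hd
    rw [hlx, sub_eq_zero] at hd
    exact Units.ext (by simpa using hd)

/-- Consequence of Lemma 4.5 combined with von Staudt's theorem (passage from
identity (30) to identity (31) in the proof of Theorem 1.3.2): under the
divisibility hypothesis with exponent `2g`, already `2g * n * N_{2g}` kills `α`,
where `N_{2g} = 2 * denominator(B_{2g}/(2g))`. -/
theorem bernoulli_denominator_kills {G : Type*} [AddCommGroup G] (n g : ℕ)
    (hn : 1 ≤ n) (hg : 1 ≤ g) (α : G)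
    (h : ∀ k l : ℕ, 0 < k → 0 < l → k ≡ l [MOD n] →
      ∃ a b : ℕ,
        ((k : ℤ) ^ a * (l : ℤ) ^ b * ((l : ℤ) ^ (2 * g) - (k : ℤ) ^ (2 * g))) • α = 0) :
    (2 * g * n * (2 * (bernoulli (2 * g) / (2 * g : ℚ)).den)) • α = 0 := by
  rw [← addOrderOf_dvd_iff_nsmul_eq_zero, Nat.dvd_iff_prime_pow_dvd_dvd]
  intro p j hp hj
  have hp' := Nat.prime_iff_prime_int.mp hp
  have key : ∀ l : ℕ, 1 ≡ l [MOD n] → ¬p ∣ l → (p : ℤ) ^ j ∣ (l : ℤ) ^ (2 * g) - 1 := by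
    intro l hl hpl
    have hl_pos : 0 < l := Nat.pos_of_ne_zero fun h0 ↦ hpl (h0 ▸ dvd_zero p)
    obtain ⟨a, b, hab⟩ := h 1 l one_pos hl_pos hl
    rw [← addOrderOf_dvd_iff_zsmul_eq_zero, Nat.cast_one, one_pow, one_pow, one_mul] at hab
    have hd : (p : ℤ) ^ j ∣ (l : ℤ) ^ b * ((l : ℤ) ^ (2 * g) - 1) :=
      dvd_trans (by exact_mod_cast hj) hab
    exact hp'.pow_dvd_of_dvd_mul_left j
      (fun hdl ↦ hpl (Int.natCast_dvd_natCast.mp (hp'.dvd_of_dvd_pow hdl))) hd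
  have key_one_add : ∀ c : ℕ, n ∣ c → p ∣ c → (p : ℤ) ^ j ∣ (1 + c : ℤ) ^ (2 * g) - 1 := by
    intro c hnc hpc
    have hl : 1 ≡ 1 + c [MOD n] := (Nat.modEq_iff_dvd' (by lia)).mpr (by simpa using hnc)
    simpa using key (1 + c) hl fun hd ↦ hp.not_dvd_one ((Nat.dvd_add_left hpc).mp hd)
  rcases hp.eq_two_or_odd' with rfl | hodd
  · have hd := two_pow_dvd_mul_of_two_pow_dvd_one_add_pow_sub_one (c := 4 * n) ⟨n, rfl⟩
      (key_one_add (4 * n) ⟨4, mul_comm _ _⟩ ⟨2 * n, by ring⟩)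
    obtain ⟨t, ht⟩ := dvd_den_bernoulli_div_of_sub_one_dvd hg Nat.prime_two (one_dvd _)
    exact hd.trans ⟨t, by rw [ht]; ring⟩
  · by_cases hdvd : p - 1 ∣ 2 * g
    · have hd := pow_dvd_mul_of_pow_dvd_one_add_pow_sub_one hp hodd (c := p * n) ⟨n, rfl⟩
        (key_one_add (p * n) ⟨p, mul_comm _ _⟩ ⟨n, rfl⟩)
      obtain ⟨t, ht⟩ := dvd_den_bernoulli_div_of_sub_one_dvd hg hp hdvd
      exact hd.trans ⟨2 * t, by rw [ht]; ring⟩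
    · by_cases hpn : p ∣ n
      · have hd := pow_dvd_mul_of_pow_dvd_one_add_pow_sub_one hp hodd hpn
          (key_one_add n dvd_rfl hpn)
        exact (mul_comm n (2 * g) ▸ hd).trans (dvd_mul_right _ _)
      · obtain ⟨l, hl, hpl, hnot⟩ := exists_modEq_one_not_dvd_pow_sub_one hp hpn hdvd
        rcases Nat.eq_zero_or_pos j with rfl | hj_pos
        · simp
        · exact absurd ((dvd_pow_self _ hj_pos.ne').trans (key l hl hpl)) hnot
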